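/- Let A be an integral domain, μ(A) its group of roots of unity, μ₂(A) = {a : a² = 1}, and μ̃(A) = μ(A)/μ₂(A). Then Tor₁^ℤ(μ̃(A), μ̃(A)) ≅ μ̃(A). (In particular, if μ(A) is infinite this follows from Tor₁^ℤ(μ̃(A), μ̃(A)) ≅ colim_n Tor₁^ℤ(μ̃₂ₙ(A), μ̃₂ₙ(A)) ≅ colim_n (μ̃₂ₙ(A) ⊗_ℤ μ̃₂ₙ(A)) ≅ μ̃(A), where μ₂ₙ(A) denotes the 2n-torsion of μ(A) and μ̃₂ₙ(A) = μ₂ₙ(A)/μ₂(A).) -/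

import Mathlib

open CategoryTheory

/-- `μ(A)`: the group of roots of unity of a domain `A`, i.e. the torsion subgroup of `A^×`. -/
def rootsOfUnitySub (A : Type) [CommRing A] [IsDomain A] : Subgroup Aˣ :=
  CommGroup.torsion Aˣ

/-- `μ₂(A)` inside `μ(A)`. -/
def mu2InMu (A : Type) [CommRing A] [IsDomain A] : Subgroup (rootsOfUnitySub A) :=
  (powMonoidHom 2 : rootsOfUnitySub A →* rootsOfUnitySub A).ker

/-- `μ̃(A) = μ(A)/μ₂(A)`, regarded as a `ℤ`-module. -/
def muTilde (A : Type) [CommRing A] [IsDomain A] : Type :=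
  Additive (rootsOfUnitySub A ⧸ mu2InMu A)

instance (A : Type) [CommRing A] [IsDomain A] : AddCommGroup (muTilde A) := by
  unfold muTilde; infer_instance

section TorOne

open MonoidalCategory

universe u

variable {R : Type u} [CommRing R]

/-- The chain complex `⋯ → 0 → F₁ → F₀` of modules, with `F₀` in degree `0`. -/
noncomputable def twoTermComplex {F₁ F₀ : ModuleCat.{u} R} (f : F₁ ⟶ F₀) :
    ChainComplex (ModuleCat.{u} R) ℕ where
  X
    | 0 => F₀
    | 1 => F₁
    | _ + 2 => ModuleCat.of R PUnit
  d
    | 1, 0 => f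
    | _, _ => 0
  shape i j h := by
    match i, j with
    | 0, _ => rfl
    | 1, 0 => exact absurd rfl h
    | 1, _ + 1 => rfl
    | _ + 2, _ => rfl
  d_comp_d' i j k hij hjk := by
    match i, j, k with
    | 0, _, _ => exact Limits.zero_comp
    | 1, 0, _ => exact Limits.comp_zero
    | 1, _ + 1, _ => exact Limits.zero_comp
    | _ + 2, _, _ => exact Limits.zero_comp

lemma subsingleton_twoTermComplex_X {F₁ F₀ : ModuleCat.{u} R} (f : F₁ ⟶ F₀) (n : ℕ) :
    Subsingleton ((twoTermComplex f).X (n + 2)) :=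
  inferInstanceAs (Subsingleton PUnit)

/-- A short exact sequence `0 → F₁ → F₀ → N → 0` with `F₁` and `F₀` projective, as a projective
resolution of `N`. -/
noncomputable def twoTermResolution {F₁ F₀ N : ModuleCat.{u} R} [Projective F₁] [Projective F₀]
    (f : F₁ ⟶ F₀) (p : F₀ ⟶ N) (hf : Function.Injective f.hom)
    (hfp : Function.Exact f.hom p.hom) (hp : Function.Surjective p.hom) :
    ProjectiveResolution N where
  complex := twoTermComplex f
  projective n := by
    match n with
    | 0 => assumption
    | 1 => assumption
    | n + 2 =>
      have := subsingleton_twoTermComplex_X f n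
      exact (ModuleCat.isZero_of_subsingleton _).projective
  π := (ChainComplex.toSingle₀Equiv _ _).symm ⟨p, by
    ext x
    exact hfp.apply_apply_eq_zero x⟩
  quasiIso := ⟨fun n => by
    match n with
    | 0 =>
      rw [ChainComplex.quasiIsoAt₀_iff, ShortComplex.quasiIso_iff_of_zeros' _ rfl rfl rfl]
      refine ⟨?_, ?_⟩
      · rw [ShortComplex.moduleCat_exact_iff_range_eq_ker]
        exact (LinearMap.exact_iff.1 hfp).symm
      · rw [ModuleCat.epi_iff_surjective]
        exact hp
    | 1 =>
      rw [quasiIsoAt_iff_exactAt' (hL := ChainComplex.exactAt_succ_single_obj ..),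
        HomologicalComplex.exactAt_iff' _ 2 1 0 (by simp) (by simp),
        ShortComplex.moduleCat_exact_iff]
      intro x hx
      exact ⟨0, (map_zero _).trans (hf (hx.trans (map_zero f.hom).symm)).symm⟩
    | n + 2 =>
      rw [quasiIsoAt_iff_exactAt' (hL := ChainComplex.exactAt_succ_single_obj ..)]
      have := subsingleton_twoTermComplex_X f n
      exact ShortComplex.exact_of_isZero_X₂ _
        (ModuleCat.isZero_of_subsingleton ((twoTermComplex f).X (n + 2)))⟩

/-- `Tor₁ᴿ(M, N)` is the kernel of `M ⊗ F₁ → M ⊗ F₀` for a short exact sequence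
`0 → F₁ → F₀ → N → 0` with `F₁` and `F₀` projective. -/
theorem nonempty_torOne_equiv_ker_lTensor {F₁ F₀ N : Type u} (M : Type u)
    [AddCommGroup F₁] [AddCommGroup F₀] [AddCommGroup N] [AddCommGroup M]
    [Module R F₁] [Module R F₀] [Module R N] [Module R M]
    [Module.Projective R F₁] [Module.Projective R F₀]
    (f : F₁ →ₗ[R] F₀) (p : F₀ →ₗ[R] N) (hf : Function.Injective f)
    (hfp : Function.Exact f p) (hp : Function.Surjective p) :
    Nonempty ((((Tor (ModuleCat.{u} R) 1).obj (ModuleCat.of R M)).obj (ModuleCat.of R N)) ≃ₗ[R]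
      LinearMap.ker (f.lTensor M)) := by
  have := (IsProjective.iff_projective (R := R) F₁).1 inferInstance
  have := (IsProjective.iff_projective (R := R) F₀).1 inferInstance
  let P := twoTermResolution (ModuleCat.ofHom f) (ModuleCat.ofHom p) hf hfp hp
  let T := (tensoringLeft (ModuleCat.{u} R)).obj (ModuleCat.of R M)
  let K := (T.mapHomologicalComplex (ComplexShape.down ℕ)).obj P.complex
  have hX : Limits.IsZero (K.X 2) :=
    T.map_isZero (ModuleCat.isZero_of_subsingleton (ModuleCat.of R PUnit.{u + 1}))
  have e₁ : K.homology 1 ≅ K.cycles 1 :=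
    (K.isoHomologyπ 2 1 (by simp) (hX.eq_of_src _ _)).symm
  have e₂ : K.cycles 1 ≅ (K.sc' 2 1 0).cycles :=
    ShortComplex.cyclesMapIso (K.isoSc' 2 1 0 (by simp) (by simp))
  exact ⟨(P.isoLeftDerivedObj T 1 ≪≫ e₁ ≪≫ e₂ ≪≫
    (K.sc' 2 1 0).moduleCatCyclesIso).toLinearEquiv⟩

end TorOne

section Telescope

/-- The endomorphism of `ℕ →₀ N` that sends a sequence `a` to `i ↦ d i • a i - a (i + 1)`. -/
noncomputable def telescope (d : ℕ → ℕ) (N : Type*) [AddCommGroup N] :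
    (ℕ →₀ N) →ₗ[ℤ] (ℕ →₀ N) :=
  Finsupp.lsum ℤ fun i => (d i : ℤ) • Finsupp.lsingle i -
    match i with
    | 0 => 0
    | j + 1 => Finsupp.lsingle j

section

variable (d : ℕ → ℕ) {N : Type*} [AddCommGroup N]

lemma telescope_single_zero (n : N) :
    telescope d N (Finsupp.single 0 n) = d 0 • Finsupp.single 0 n := by
  simp [telescope]

lemma telescope_single_succ (i : ℕ) (n : N) :
    telescope d N (Finsupp.single (i + 1) n) =
      d (i + 1) • Finsupp.single (i + 1) n - Finsupp.single i n := by
  simp [telescope]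

lemma telescope_apply (a : ℕ →₀ N) (i : ℕ) :
    telescope d N a i = d i • a i - a (i + 1) := by
  induction a using Finsupp.induction_linear with
  | zero => simp
  | add a b ha hb =>
    rw [map_add, Finsupp.add_apply, ha, hb, Finsupp.add_apply, Finsupp.add_apply, smul_add]
    abel
  | single j n =>
    cases j with
    | zero =>
      rw [telescope_single_zero, Finsupp.smul_apply, Finsupp.single_eq_of_ne (Nat.succ_ne_zero i),
        sub_zero]
      rcases eq_or_ne i 0 with rfl | hi
      · rfl
      · rw [Finsupp.single_eq_of_ne hi, smul_zero, smul_zero]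
    | succ j =>
      rw [telescope_single_succ, Finsupp.sub_apply, Finsupp.smul_apply]
      rcases eq_or_ne i (j + 1) with rfl | hi
      · simp
      · simp [Finsupp.single_apply, hi.symm]

lemma mem_ker_telescope_iff (a : ℕ →₀ N) :
    a ∈ LinearMap.ker (telescope d N) ↔ ∀ i, a (i + 1) = d i • a i := by
  simp only [LinearMap.mem_ker, Finsupp.ext_iff, telescope_apply, Finsupp.zero_apply, sub_eq_zero]
  exact forall_congr' fun i => eq_comm

lemma apply_eq_prod_smul_of_mem_ker_telescope {a : ℕ →₀ N}
    (ha : a ∈ LinearMap.ker (telescope d N)) (i : ℕ) :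
    a i = (∏ j ∈ Finset.range i, d j) • a 0 := by
  induction i with
  | zero => simp
  | succ i ih =>
    rw [(mem_ker_telescope_iff d a).1 ha, ih, smul_smul, Finset.prod_range_succ, mul_comm]

lemma telescope_injective [IsAddTorsionFree N] (hd : ∀ i, d i ≠ 0) :
    Function.Injective (telescope d N) := by
  rw [← LinearMap.ker_eq_bot, LinearMap.ker_eq_bot']
  intro a ha
  have key := apply_eq_prod_smul_of_mem_ker_telescope d (LinearMap.mem_ker.2 ha)
  obtain ⟨i, hi⟩ := Infinite.exists_notMem_finset a.support
  have h0 : a 0 = 0 := by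
    have := (key i).symm.trans (Finsupp.notMem_support_iff.1 hi)
    exact (smul_eq_zero.1 this).resolve_left (Finset.prod_ne_zero_iff.2 fun j _ => hd j)
  ext i
  rw [key i, h0, smul_zero, Finsupp.zero_apply]

/-- If every element of `N` is killed by some product `d 0 * ⋯ * d (i - 1)`, a sequence in the
kernel of `telescope d N` is freely determined by its initial term. -/
noncomputable def kerTelescopeEquiv
    (hN : ∀ n : N, ∃ i, (∏ j ∈ Finset.range i, d j) • n = 0) :
    LinearMap.ker (telescope d N) ≃ₗ[ℤ] N :=
  LinearEquiv.ofBijective ((Finsupp.lapply 0).domRestrict _) <| by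
    constructor
    · intro a b h
      replace h : (a : ℕ →₀ N) 0 = (b : ℕ →₀ N) 0 := h
      ext i
      rw [apply_eq_prod_smul_of_mem_ker_telescope d a.2 i, h,
        ← apply_eq_prod_smul_of_mem_ker_telescope d b.2 i]
    · intro n
      obtain ⟨k, hk⟩ := hN n
      refine ⟨⟨Finsupp.onFinset (Finset.range k)
        (fun i => (∏ j ∈ Finset.range i, d j) • n) fun i hi => ?_, ?_⟩, ?_⟩
      · contrapose! hi
        obtain ⟨c, hc⟩ := Finset.prod_dvd_prod_of_subset (Finset.range k) (Finset.range i) d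
          (Finset.range_mono (by simpa using hi))
        rw [hc, mul_comm, mul_smul, hk, smul_zero]
      · rw [mem_ker_telescope_iff]
        intro i
        simp only [Finsupp.onFinset_apply, Finset.prod_range_succ, smul_smul, mul_comm]
      · simp

lemma finsuppScalarRight_lTensor_telescope (t : TensorProduct ℤ N (ℕ →₀ ℤ)) :
    TensorProduct.finsuppScalarRight ℤ ℤ N ℕ ((telescope d ℤ).lTensor N t) =
      telescope d N (TensorProduct.finsuppScalarRight ℤ ℤ N ℕ t) := by
  induction t with
  | zero => simp
  | add s t hs ht => rw [map_add, map_add, hs, ht, map_add, map_add]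
  | tmul n a =>
    ext i
    rw [telescope_apply]
    simp [telescope_apply, sub_smul, mul_smul]

/-- The kernel of `telescope d ℤ` tensored with `N` is the kernel of `telescope d N`. -/
noncomputable def kerLTensorTelescopeEquiv :
    LinearMap.ker ((telescope d ℤ).lTensor N) ≃ₗ[ℤ] LinearMap.ker (telescope d N) :=
  (TensorProduct.finsuppScalarRight ℤ ℤ N ℕ).ofSubmodules _ _ <| by
    ext a
    rw [Submodule.map_equiv_eq_comap_symm, Submodule.mem_comap, LinearMap.mem_ker,
      LinearMap.mem_ker, ← (TensorProduct.finsuppScalarRight ℤ ℤ N ℕ).map_eq_zero_iff,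
      finsuppScalarRight_lTensor_telescope]
    simp

end

section

variable {M : Type*} [AddCommGroup M] {x : ℕ → M} {d : ℕ → ℕ}

lemma exists_sub_smul_single_mem_range_telescope (a : ℕ →₀ ℤ) :
    ∃ (i : ℕ) (c : ℤ), a - c • Finsupp.single i 1 ∈ LinearMap.range (telescope d ℤ) := by
  have up (i : ℕ) (c : ℤ) (k : ℕ) : ∃ c' : ℤ, c • Finsupp.single i 1 -
      c' • Finsupp.single (i + k) 1 ∈ LinearMap.range (telescope d ℤ) := by
    induction k with
    | zero => exact ⟨c, by simp⟩
    | succ k ih =>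
      obtain ⟨c', hc'⟩ := ih
      refine ⟨c' * d (i + k + 1), ?_⟩
      have h := Submodule.smul_mem _ c'
        (LinearMap.mem_range_self (telescope d ℤ) (Finsupp.single (i + k + 1) 1))
      rw [telescope_single_succ, smul_sub, ← natCast_zsmul, smul_smul] at h
      convert sub_mem hc' h using 1
      rw [← add_assoc]
      abel
  induction a using Finsupp.induction_linear with
  | zero => exact ⟨0, 0, by simp⟩
  | single i c => exact ⟨i, c, by simp⟩
  | add a b ha hb =>
    obtain ⟨i, c, ha⟩ := ha
    obtain ⟨j, e, hb⟩ := hb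
    obtain ⟨c', hc'⟩ := up i c j
    obtain ⟨e', he'⟩ := up j e i
    refine ⟨i + j, c' + e', ?_⟩
    convert add_mem (add_mem ha hc') (add_mem hb he') using 1
    rw [add_smul, add_comm j i]
    abel

lemma prod_smul_single_mem_range_telescope (i : ℕ) :
    (∏ j ∈ Finset.range (i + 1), d j) • Finsupp.single i (1 : ℤ) ∈
      LinearMap.range (telescope d ℤ) := by
  induction i with
  | zero => exact ⟨Finsupp.single 0 1, by simp [telescope_single_zero]⟩
  | succ i ih =>
    have h := Submodule.smul_mem _ ((∏ j ∈ Finset.range (i + 1), d j : ℕ) : ℤ)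
      (LinearMap.mem_range_self (telescope d ℤ) (Finsupp.single (i + 1) 1))
    rw [telescope_single_succ, smul_sub, natCast_zsmul, natCast_zsmul, smul_smul,
      ← Finset.prod_range_succ] at h
    simpa using add_mem h ih

/-- The relations `d 0 • x 0 = 0` and `d (i + 1) • x (i + 1) = x i` present the group generated by
the `x i`, when these have the largest order that the relations allow. -/
lemma exact_telescope_linearCombination (hx : ∀ i, d (i + 1) • x (i + 1) = x i)
    (ho : ∀ i, addOrderOf (x i) = ∏ j ∈ Finset.range (i + 1), d j) :
    Function.Exact (telescope d ℤ) (Finsupp.linearCombination ℤ x) := by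
  have hcomp : Finsupp.linearCombination ℤ x ∘ₗ telescope d ℤ = 0 := by
    ext i
    cases i with
    | zero =>
      have := addOrderOf_nsmul_eq_zero (x 0)
      rw [ho] at this
      simpa [telescope_single_zero] using this
    | succ i => simp [telescope_single_succ, hx]
  refine LinearMap.exact_of_comp_of_mem_range hcomp fun a ha => ?_
  obtain ⟨i, c, b, hb⟩ := exists_sub_smul_single_mem_range_telescope (d := d) a
  have hc : c • x i = 0 := by
    have := LinearMap.congr_fun hcomp b
    rw [LinearMap.comp_apply, hb, map_sub, ha] at this
    simpa using this
  obtain ⟨e, rfl⟩ := addOrderOf_dvd_iff_zsmul_eq_zero.2 hc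
  rw [ho] at hb
  have h := add_mem (LinearMap.mem_range.2 ⟨b, hb⟩)
    (Submodule.smul_mem _ e (prod_smul_single_mem_range_telescope (d := d) i))
  rwa [mul_comm, mul_smul, natCast_zsmul, sub_add_cancel] at h

end

/-- `Tor₁(M, M) ≅ M` for a group `M` that is the union of a chain of finite cyclic subgroups
`⟨x 0⟩ ≤ ⟨x 1⟩ ≤ ⋯`. -/
theorem nonempty_torOne_self_equiv_of_chain {M : Type} [AddCommGroup M] {x : ℕ → M} {d : ℕ → ℕ}
    (hd : ∀ i, d i ≠ 0) (hx : ∀ i, d (i + 1) • x (i + 1) = x i)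
    (ho : ∀ i, addOrderOf (x i) = ∏ j ∈ Finset.range (i + 1), d j)
    (hM : ∀ m, ∃ i, m ∈ AddSubgroup.zmultiples (x i)) :
    Nonempty ((((Tor (ModuleCat ℤ) 1).obj (ModuleCat.of ℤ M)).obj (ModuleCat.of ℤ M)) ≃ₗ[ℤ]
      M) := by
  obtain ⟨e⟩ := nonempty_torOne_equiv_ker_lTensor M (telescope d ℤ)
    (Finsupp.linearCombination ℤ x) (telescope_injective d hd)
    (exact_telescope_linearCombination hx ho) fun m => by
      obtain ⟨i, c, rfl⟩ := hM m
      exact ⟨Finsupp.single i c, by simp⟩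
  refine ⟨e ≪≫ₗ kerLTensorTelescopeEquiv d ≪≫ₗ kerTelescopeEquiv d fun m => ?_⟩
  obtain ⟨i, c, rfl⟩ := hM m
  refine ⟨i + 1, ?_⟩
  rw [← ho]
  simp only [smul_comm _ c, addOrderOf_nsmul_eq_zero, smul_zero]

end Telescope

section Chain

/-- Every element `x` of a finite cyclic group `⟨y⟩` is of the form `d • z` with `z` a generator and
`d` the index of `⟨x⟩`. -/
lemma exists_zmultiples_eq_and_nsmul_eq {M : Type*} [AddCommGroup M] {x y : M}
    (hy : IsOfFinAddOrder y) (hxy : x ∈ AddSubgroup.zmultiples y) :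
    ∃ (z : M) (d : ℕ), AddSubgroup.zmultiples z = AddSubgroup.zmultiples y ∧ d ≠ 0 ∧
      d • z = x ∧ addOrderOf z = addOrderOf x * d := by
  obtain ⟨c, rfl⟩ := hy.mem_multiples_iff_mem_zmultiples.2 hxy
  have hn : 0 < addOrderOf y := hy.addOrderOf_pos
  have hg : (addOrderOf y).gcd c ≠ 0 := (Nat.gcd_pos_of_pos_left c hn).ne'
  obtain ⟨k, a, hka, hk, ha⟩ := Nat.exists_coprime (addOrderOf y) c
  have : NeZero (addOrderOf y) := ⟨hn.ne'⟩
  obtain ⟨u, hu⟩ := ZMod.unitsMap_surjective ⟨_, hk⟩ (ZMod.unitOfCoprime a hka.symm)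
  have hcop : (addOrderOf y).Coprime (u : ZMod (addOrderOf y)).val :=
    (ZMod.val_coe_unit_coprime u).symm
  have hmod : (u : ZMod (addOrderOf y)).val ≡ a [MOD k] := by
    rw [← ZMod.natCast_eq_natCast_iff, ZMod.natCast_val, ← ZMod.unitsMap_val ⟨_, hk⟩, hu,
      ZMod.coe_unitOfCoprime]
  refine ⟨(u : ZMod (addOrderOf y)).val • y, (addOrderOf y).gcd c, le_antisymm ?_ ?_, hg, ?_, ?_⟩
  · exact AddSubgroup.zmultiples_le.2 (nsmul_mem (AddSubgroup.mem_zmultiples y) _)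
  · obtain ⟨e, he⟩ := exists_nsmul_eq_self_of_coprime hcop.symm
    exact AddSubgroup.zmultiples_le.2
      (AddSubgroup.mem_zmultiples_iff.2 ⟨e, (natCast_zsmul _ e).trans he⟩)
  · rw [smul_smul, mul_comm]
    refine nsmul_eq_nsmul_iff_modEq.2 ?_
    have h := hmod.mul_right' ((addOrderOf y).gcd c)
    rwa [← hk, ← ha] at h
  · rw [hcop.addOrderOf_nsmul, hy.addOrderOf_nsmul, Nat.div_mul_cancel (Nat.gcd_dvd_left _ _)]

/-- A torsion group each of whose `n`-torsion subgroups is cyclic is the union of a chain of finite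
cyclic subgroups. -/
lemma exists_chain_of_cyclic_torsionBy {M : Type*} [AddCommGroup M] (hM : IsAddTorsion M)
    (hc : ∀ n : ℕ, 0 < n → ∃ y : M, n • y = 0 ∧
      ∀ m : M, n • m = 0 → m ∈ AddSubgroup.zmultiples y) :
    ∃ (x : ℕ → M) (d : ℕ → ℕ), (∀ i, d i ≠ 0) ∧ (∀ i, d (i + 1) • x (i + 1) = x i) ∧
      (∀ i, addOrderOf (x i) = ∏ j ∈ Finset.range (i + 1), d j) ∧
      ∀ m, ∃ i, m ∈ AddSubgroup.zmultiples (x i) := by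
  have step (i : ℕ) (x : M) (hx : i.factorial • x = 0) : ∃ (z : M) (d : ℕ),
      (i + 1).factorial • z = 0 ∧
      (∀ m : M, (i + 1).factorial • m = 0 → m ∈ AddSubgroup.zmultiples z) ∧
      d ≠ 0 ∧ d • z = x ∧ addOrderOf z = addOrderOf x * d := by
    obtain ⟨y, hy, hy'⟩ := hc _ (i + 1).factorial_pos
    obtain ⟨z, d, hz, h⟩ := exists_zmultiples_eq_and_nsmul_eq (hM y)
      (hy' x (by rw [Nat.factorial_succ, mul_smul, hx, smul_zero]))
    refine ⟨z, d, ?_, by rwa [hz], h⟩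
    obtain ⟨c, rfl⟩ : z ∈ AddSubgroup.zmultiples y := hz ▸ AddSubgroup.mem_zmultiples z
    rw [smul_comm, hy, smul_zero]
  choose! z d h₁ h₂ h₃ h₄ h₅ using step
  let x : ℕ → M := fun i => Nat.rec 0 (fun i x => z i x) i
  have hx0 : x 0 = 0 := rfl
  have hxs (i : ℕ) : x (i + 1) = z i (x i) := rfl
  have hx (i : ℕ) : i.factorial • x i = 0 := by
    induction i with
    | zero => rw [hx0, smul_zero]
    | succ i ih => exact h₁ i _ ih
  refine ⟨x, fun i => Nat.casesOn i 1 fun i => d i (x i), ?_, fun i => h₄ i _ (hx i), ?_, ?_⟩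
  · rintro (_ | i)
    · exact one_ne_zero
    · exact h₃ i _ (hx i)
  · intro i
    induction i with
    | zero => simp [hx0]
    | succ i ih => rw [Finset.prod_range_succ, ← ih, hxs, h₅ i _ (hx i)]
  · intro m
    obtain ⟨n, hn, hnm⟩ := isOfFinAddOrder_iff_nsmul_eq_zero.1 (hM m)
    refine ⟨n + 1, h₂ n _ (hx n) m ?_⟩
    obtain ⟨c, hc⟩ := Nat.dvd_factorial hn n.le_succ
    rw [hc, mul_comm, mul_smul, hnm, smul_zero]

/-- The `n`-torsion of a group of units of a domain is cyclic. -/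
lemma exists_forall_mem_zpowers_of_pow_eq_one {A G : Type*} [CommRing A] [IsDomain A] [CommGroup G]
    (φ : G →* Aˣ) (hφ : Function.Injective φ) (n : ℕ) (hn : 0 < n) :
    ∃ y : G, y ^ n = 1 ∧ ∀ g : G, g ^ n = 1 → g ∈ Subgroup.zpowers y := by
  have : NeZero n := ⟨hn.ne'⟩
  let H : Subgroup G := (powMonoidHom n : G →* G).ker
  have hH (g : H) : (g : G) ^ n = 1 := g.2
  let ψ : H →* rootsOfUnity n A := (φ.comp H.subtype).codRestrict _ fun g => by
    rw [mem_rootsOfUnity, MonoidHom.comp_apply, ← map_pow, H.subtype_apply, hH, map_one]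
  have hψ : Function.Injective ψ := fun a b h =>
    Subtype.ext (hφ (congrArg Subtype.val h))
  have : IsCyclic H := isCyclic_of_injective ψ hψ
  obtain ⟨y, hy⟩ := IsCyclic.exists_generator (α := H)
  refine ⟨y, hH y, fun g hg => ?_⟩
  obtain ⟨c, hc⟩ := hy ⟨g, hg⟩
  exact ⟨c, congrArg Subtype.val hc⟩

/-- `Tor₁(G, G) ≅ G` for a torsion group `G` that embeds into the units of a domain. -/
theorem nonempty_torOne_self_equiv_of_injective_units {A : Type*} {G : Type} [CommRing A]
    [IsDomain A] [CommGroup G] (hG : IsMulTorsion G) (φ : G →* Aˣ) (hφ : Function.Injective φ) :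
    Nonempty ((((Tor (ModuleCat ℤ) 1).obj (ModuleCat.of ℤ (Additive G))).obj
      (ModuleCat.of ℤ (Additive G))) ≃+ Additive G) := by
  have htors : IsAddTorsion (Additive G) := fun m =>
    (isOfFinAddOrder_ofMul_iff (x := m.toMul)).2 (hG m.toMul)
  obtain ⟨x, d, hd, hx, ho, hM⟩ := exists_chain_of_cyclic_torsionBy htors fun n hn => by
    obtain ⟨y, hy, h⟩ := exists_forall_mem_zpowers_of_pow_eq_one φ hφ n hn
    exact ⟨Additive.ofMul y, hy, fun m hm => h m.toMul hm⟩
  exact (nonempty_torOne_self_equiv_of_chain hd hx ho hM).map LinearEquiv.toAddEquiv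

end Chain

/-- Squaring embeds `μ̃(A)` into `A^×`. -/
lemma exists_injective_muTilde (A : Type) [CommRing A] [IsDomain A] :
    ∃ φ : rootsOfUnitySub A ⧸ mu2InMu A →* Aˣ, Function.Injective φ := by
  let ψ : rootsOfUnitySub A ⧸ mu2InMu A →* rootsOfUnitySub A :=
    QuotientGroup.kerLift (powMonoidHom 2 : rootsOfUnitySub A →* rootsOfUnitySub A)
  have hψ : Function.Injective ψ := QuotientGroup.kerLift_injective _
  exact ⟨(rootsOfUnitySub A).subtype.comp ψ, Subtype.val_injective.comp hψ⟩

lemma isMulTorsion_quotient_mu2InMu (A : Type) [CommRing A] [IsDomain A] :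
    IsMulTorsion (rootsOfUnitySub A ⧸ mu2InMu A) :=
  IsMulTorsion.of_surjective (QuotientGroup.mk'_surjective (mu2InMu A)) fun g =>
    Submonoid.isOfFinOrder_coe.1 ((CommGroup.mem_torsion _).1 g.2)

/-- **Statement 11.** For an integral domain `A`, writing `μ̃(A) = μ(A)/μ₂(A)`, one has
`Tor₁^ℤ(μ̃(A), μ̃(A)) ≅ μ̃(A)`. -/
theorem tor_muTilde (A : Type) [CommRing A] [IsDomain A] :
    Nonempty (((((Tor (ModuleCat ℤ) 1).obj (ModuleCat.of ℤ (muTilde A))).obj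
      (ModuleCat.of ℤ (muTilde A))) : Type) ≃+ muTilde A) := by
  obtain ⟨φ, hφ⟩ := exists_injective_muTilde A
  exact nonempty_torOne_self_equiv_of_injective_units
    (G := rootsOfUnitySub A ⧸ mu2InMu A) (isMulTorsion_quotient_mu2InMu A) φ hφ
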